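/- arXiv:2302.05522 — 10 statements merged into one kernel-verified Lean document; each statement's English description precedes it below -/
import Mathlib

section
/- Let w be a Bergman weight with h_0 = 1 whose moments satisfy h_{2m}/h_{2(m-1)} ≥ h_{2(m+1)}/((m+1)·h_{2(m-1)}) + (m/(m+1))·h_{2(m+1)}/h_{2m} for all integers m ≥ 1. Then for every real q ≥ 1, ∑_{n=0}^∞ q^n h_{2n}/(n!)² ≤ (∑_{n=0}^∞ h_{2n}/(n!)²)^q. -/
open MeasureTheory

/-- The `m`-th moment `h_m = ∫₀¹ ρ^{m+1} w(ρ) dρ` of a weight `w` on `[0,1)`. -/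
noncomputable def moment (w : ℝ → ℝ) (m : ℕ) : ℝ :=
  ∫ ρ in (0:ℝ)..1, ρ ^ (m + 1) * w ρ

/-- The exponential generating function `∑ bₙ tⁿ / n!` of a real sequence. -/
noncomputable def egf (b : ℕ → ℝ) (t : ℝ) : ℝ :=
  ∑' n : ℕ, b n * t ^ n / (n.factorial : ℝ)

lemma summable_egf {b : ℕ → ℝ} (hb : ∀ n, 0 ≤ b n) (hb1 : ∀ n, b n ≤ 1) (t : ℝ) :
    Summable fun n : ℕ => b n * t ^ n / (n.factorial : ℝ) := by
  refine Summable.of_norm_bounded (Real.summable_pow_div_factorial |t|) fun n => ?_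
  have hf : (0 : ℝ) < n.factorial := by exact_mod_cast n.factorial_pos
  rw [Real.norm_eq_abs, abs_div, abs_mul, abs_pow, abs_of_nonneg (hb n), abs_of_pos hf]
  gcongr
  exact mul_le_of_le_one_left (by positivity) (hb1 n)

lemma hasDerivAt_egf {b : ℕ → ℝ} (hb : ∀ n, 0 ≤ b n) (hb1 : ∀ n, b n ≤ 1) (t : ℝ) :
    HasDerivAt (egf b) (egf (fun n => b (n + 1)) t) t := by
  have hshift : ∀ (x : ℝ) (n : ℕ), b (n + 1) * ((n + 1 : ℕ) * x ^ (n + 1 - 1)) /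
      ((n + 1).factorial : ℝ) = b (n + 1) * x ^ n / (n.factorial : ℝ) := by
    intro x n
    have hf : (n.factorial : ℝ) ≠ 0 := by exact_mod_cast n.factorial_ne_zero
    have hn : (n : ℝ) + 1 ≠ 0 := by positivity
    rw [Nat.factorial_succ]
    push_cast [add_tsub_cancel_right]
    field_simp
  have hsum : ∀ x : ℝ, Summable fun n : ℕ => b n * (n * x ^ (n - 1)) / (n.factorial : ℝ) := by
    intro x
    rw [← summable_nat_add_iff 1]
    simp_rw [hshift x]
    exact summable_egf (fun n => hb _) (fun n => hb1 _) x
  have hderiv : HasDerivAt (egf b)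
      (∑' n : ℕ, b n * (n * t ^ (n - 1)) / (n.factorial : ℝ)) t := by
    refine hasDerivAt_tsum_of_isPreconnected (t := Metric.ball (0 : ℝ) (|t| + 1))
      (hsum (|t| + 1)) Metric.isOpen_ball (convex_ball _ _).isPreconnected
      (fun n y _ => ((hasDerivAt_pow n y).const_mul (b n)).div_const _) ?_
      (y₀ := 0) (by simp; positivity) (summable_egf hb hb1 0) (by simp)
    intro n y hy
    have hy' : |y| ≤ |t| + 1 := by simpa using (Metric.mem_ball.1 hy).le
    have hf : (0 : ℝ) < n.factorial := by exact_mod_cast n.factorial_pos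
    rw [Real.norm_eq_abs, abs_div, abs_mul, abs_mul, abs_pow, abs_of_nonneg (hb n),
      abs_of_pos hf, Nat.abs_cast]
    have := hb n
    gcongr
  convert hderiv using 1
  rw [(hsum t).tsum_eq_zero_add]
  simp_rw [hshift t]
  simp [egf]

lemma mul_le_mul_of_antitone_ratio {b : ℕ → ℝ} (hb : ∀ n, 0 < b n)
    (hr : Antitone fun n => b (n + 1) / b n) {m n : ℕ} (h : m ≤ n) :
    b (n + 1) * b m ≤ b (m + 1) * b n :=
  (div_le_div_iff₀ (hb n) (hb m)).1 (hr h)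

lemma pow_mul_pow_le_of_le {s t : ℝ} (hs : 0 ≤ s) (hst : s ≤ t) {m n : ℕ} (h : m ≤ n) :
    s ^ n * t ^ m ≤ t ^ n * s ^ m := by
  obtain ⟨k, rfl⟩ := Nat.exists_eq_add_of_le h
  have hk : s ^ k ≤ t ^ k := pow_le_pow_left₀ hs hst k
  have ht : 0 ≤ t := hs.trans hst
  calc s ^ (m + k) * t ^ m = s ^ m * t ^ m * s ^ k := by ring
    _ ≤ s ^ m * t ^ m * t ^ k := by gcongr
    _ = t ^ (m + k) * s ^ m := by ring

lemma tsum_le_tsum_of_add_swap_le {P Q : ℕ × ℕ → ℝ} (hP : Summable P) (hQ : Summable Q)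
    (h : ∀ z, P z + P z.swap ≤ Q z + Q z.swap) : ∑' z, P z ≤ ∑' z, Q z := by
  have hP' : Summable fun z : ℕ × ℕ => P z.swap := (Equiv.prodComm ℕ ℕ).summable_iff.2 hP
  have hQ' : Summable fun z : ℕ × ℕ => Q z.swap := (Equiv.prodComm ℕ ℕ).summable_iff.2 hQ
  have eP : ∑' z : ℕ × ℕ, P z.swap = ∑' z, P z := (Equiv.prodComm ℕ ℕ).tsum_eq P
  have eQ : ∑' z : ℕ × ℕ, Q z.swap = ∑' z, Q z := (Equiv.prodComm ℕ ℕ).tsum_eq Q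
  have := (hP.add hP').tsum_le_tsum h (hQ.add hQ')
  rw [hP.tsum_add hP', hQ.tsum_add hQ', eP, eQ] at this
  linarith

/-- Cross-multiplied form of the monotonicity of the logarithmic derivative of `egf b`. -/
lemma egf_shift_mul_egf_le {b : ℕ → ℝ} (hb : ∀ n, 0 < b n) (hb1 : ∀ n, b n ≤ 1)
    (hr : Antitone fun n => b (n + 1) / b n) {s t : ℝ} (hs : 0 ≤ s) (hst : s ≤ t) :
    egf (fun n => b (n + 1)) t * egf b s ≤ egf (fun n => b (n + 1)) s * egf b t := by
  have hF := fun x => (summable_egf (fun n => (hb n).le) hb1 x).norm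
  have hG := fun x => (summable_egf (b := fun n => b (n + 1))
    (fun n => (hb _).le) (fun n => hb1 _) x).norm
  unfold egf
  rw [tsum_mul_tsum_of_summable_norm (hG t) (hF s), tsum_mul_tsum_of_summable_norm (hG s) (hF t)]
  have h1 := summable_mul_of_summable_norm (hG t) (hF s)
  have h2 := summable_mul_of_summable_norm (hG s) (hF t)
  refine tsum_le_tsum_of_add_swap_le h1 h2 ?_
  rintro ⟨n, m⟩
  have hprod : 0 ≤ (b (m + 1) * b n - b (n + 1) * b m) * (t ^ n * s ^ m - s ^ n * t ^ m) := by
    rcases le_total m n with h | h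
    · exact mul_nonneg (sub_nonneg.2 (mul_le_mul_of_antitone_ratio hb hr h))
        (sub_nonneg.2 (pow_mul_pow_le_of_le hs hst h))
    · refine mul_nonneg_of_nonpos_of_nonpos
        (sub_nonpos.2 (mul_le_mul_of_antitone_ratio hb hr h)) (sub_nonpos.2 ?_)
      linarith [pow_mul_pow_le_of_le hs hst h]
  have hnm : (0 : ℝ) < n.factorial * m.factorial := by positivity
  have := div_nonneg hprod hnm.le
  simp only [Prod.swap_prod_mk]
  rw [← sub_nonneg]
  refine this.trans_eq ?_
  field_simp
  ring

lemma one_le_egf {b : ℕ → ℝ} (hb : ∀ n, 0 ≤ b n) (hb1 : ∀ n, b n ≤ 1) (h0 : b 0 = 1)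
    {t : ℝ} (ht : 0 ≤ t) : 1 ≤ egf b t := by
  have := (summable_egf hb hb1 t).le_tsum 0 fun n _ => by have := hb n; positivity
  simpa [egf, h0] using this

lemma egf_zero (b : ℕ → ℝ) : egf b 0 = b 0 := by
  unfold egf
  rw [tsum_eq_single 0 fun n hn => by simp [hn]]
  simp

lemma concaveOn_log_egf {b : ℕ → ℝ} (hb : ∀ n, 0 < b n) (hb1 : ∀ n, b n ≤ 1) (h0 : b 0 = 1)
    (hr : Antitone fun n => b (n + 1) / b n) :
    ConcaveOn ℝ (Set.Ici 0) fun t => Real.log (egf b t) := by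
  have hpos : ∀ t : ℝ, 0 ≤ t → 0 < egf b t := fun t ht =>
    zero_lt_one.trans_le (one_le_egf (fun n => (hb n).le) hb1 h0 ht)
  have hd : ∀ t : ℝ, 0 ≤ t → HasDerivAt (fun t => Real.log (egf b t))
      (egf (fun n => b (n + 1)) t / egf b t) t := fun t ht =>
    (hasDerivAt_egf (fun n => (hb n).le) hb1 t).log (hpos t ht).ne'
  refine AntitoneOn.concaveOn_of_deriv (convex_Ici 0)
    (fun t ht => (hd t ht).continuousAt.continuousWithinAt)
    (fun t ht => (hd t (interior_subset ht)).differentiableAt.differentiableWithinAt) ?_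
  intro s hs t ht hst
  have hs := interior_subset hs
  have ht := interior_subset ht
  rw [(hd s hs).deriv, (hd t ht).deriv, div_le_div_iff₀ (hpos t ht) (hpos s hs)]
  exact egf_shift_mul_egf_le hb hb1 hr hs hst

lemma egf_le_rpow {b : ℕ → ℝ} (hb : ∀ n, 0 < b n) (hb1 : ∀ n, b n ≤ 1) (h0 : b 0 = 1)
    (hr : Antitone fun n => b (n + 1) / b n) {q : ℝ} (hq : 1 ≤ q) :
    egf b q ≤ egf b 1 ^ q := by
  have hq0 : 0 < q := zero_lt_one.trans_le hq
  have hpos : ∀ t : ℝ, 0 ≤ t → 0 < egf b t := fun t ht =>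
    zero_lt_one.trans_le (one_le_egf (fun n => (hb n).le) hb1 h0 ht)
  have h := (concaveOn_log_egf hb hb1 h0 hr).2 (Set.mem_Ici.2 hq0.le) (Set.mem_Ici.2 le_rfl)
    (inv_nonneg.2 hq0.le) (sub_nonneg.2 (inv_le_one_of_one_le₀ hq)) (by ring)
  simp only [smul_eq_mul, mul_zero, add_zero, egf_zero, h0, Real.log_one,
    inv_mul_cancel₀ hq0.ne'] at h
  rw [← Real.log_le_log_iff (hpos q hq0.le) (Real.rpow_pos_of_pos (hpos 1 zero_le_one) q),
    Real.log_rpow (hpos 1 zero_le_one)]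
  rwa [inv_mul_le_iff₀ hq0] at h

lemma ae_restrict_nonneg_pow_mul {w : ℝ → ℝ} (hw : ∀ ρ ∈ Set.Ico (0 : ℝ) 1, 0 ≤ w ρ) (m : ℕ) :
    0 ≤ᵐ[volume.restrict (Set.Ioc 0 1)] fun ρ => ρ ^ (m + 1) * w ρ := by
  rw [← Measure.restrict_congr_set Ioo_ae_eq_Ioc]
  filter_upwards [ae_restrict_mem measurableSet_Ioo] with ρ hρ
  exact mul_nonneg (pow_nonneg hρ.1.le _) (hw ρ ⟨hρ.1.le, hρ.2⟩)

lemma moment_le_moment_zero {w : ℝ → ℝ} (hw : ∀ ρ ∈ Set.Ico (0 : ℝ) 1, 0 ≤ w ρ)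
    (hint : ∀ m : ℕ, IntervalIntegrable (fun ρ => ρ ^ (m + 1) * w ρ) volume 0 1) (m : ℕ) :
    moment w m ≤ moment w 0 := by
  refine intervalIntegral.integral_mono_on_of_le_Ioo zero_le_one (hint m) (hint 0) fun ρ hρ => ?_
  exact mul_le_mul_of_nonneg_right (pow_le_pow_of_le_one hρ.1.le hρ.2.le (by omega))
    (hw ρ ⟨hρ.1.le, hρ.2⟩)

lemma moment_pos {w : ℝ → ℝ} (hw : ∀ ρ ∈ Set.Ico (0 : ℝ) 1, 0 ≤ w ρ)
    (hint : ∀ m : ℕ, IntervalIntegrable (fun ρ => ρ ^ (m + 1) * w ρ) volume 0 1)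
    (h0 : moment w 0 ≠ 0) (m : ℕ) : 0 < moment w m := by
  have hnn := ae_restrict_nonneg_pow_mul hw m
  refine lt_of_le_of_ne
    (intervalIntegral.integral_nonneg_of_ae_restrict zero_le_one ?_) fun h => h0 ?_
  · rwa [← Measure.restrict_congr_set Ioc_ae_eq_Icc]
  · have hz := (intervalIntegral.integral_eq_zero_iff_of_le_of_nonneg_ae zero_le_one hnn
      (hint m)).1 h.symm
    refine (intervalIntegral.integral_eq_zero_iff_of_le_of_nonneg_ae zero_le_one
      (ae_restrict_nonneg_pow_mul hw 0) (hint 0)).2 ?_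
    filter_upwards [hz, ae_restrict_mem measurableSet_Ioc] with ρ h1 h2
    have : w ρ = 0 := (mul_eq_zero.1 h1).resolve_left (pow_ne_zero _ h2.1.ne')
    simp [this]

/-- **Theorem 2 (Bernoulli type inequality for moment sequences).**
If the moments of a Bergman weight `w` satisfy
`h_{2m}/h_{2(m-1)} ≥ h_{2(m+1)}/((m+1)h_{2(m-1)}) + (m/(m+1))·h_{2(m+1)}/h_{2m}`
for all `m ≥ 1`, then `∑ qⁿ h_{2n}/(n!)² ≤ (∑ h_{2n}/(n!)²)^q` for all real `q ≥ 1`. -/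
theorem bernoulli_type_inequality (w : ℝ → ℝ)
    (hw_nonneg : ∀ ρ ∈ Set.Ico (0:ℝ) 1, 0 ≤ w ρ)
    (hw_int : ∀ m : ℕ, IntervalIntegrable (fun ρ => ρ ^ (m + 1) * w ρ) volume 0 1)
    (h0 : moment w 0 = 1)
    (hcond : ∀ m : ℕ, 1 ≤ m →
      moment w (2 * (m + 1)) / ((m + 1) * moment w (2 * (m - 1))) +
          ((m : ℝ) / (m + 1)) * (moment w (2 * (m + 1)) / moment w (2 * m)) ≤
        moment w (2 * m) / moment w (2 * (m - 1)))
    (q : ℝ) (hq : 1 ≤ q) :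
    ∑' n : ℕ, q ^ n * moment w (2 * n) / (Nat.factorial n : ℝ) ^ 2 ≤
      (∑' n : ℕ, moment w (2 * n) / (Nat.factorial n : ℝ) ^ 2) ^ q := by
  have hpos : ∀ m, 0 < moment w m := moment_pos hw_nonneg hw_int (by simp [h0])
  have hfac : ∀ n : ℕ, (0 : ℝ) < n.factorial := fun n => by exact_mod_cast n.factorial_pos
  set b : ℕ → ℝ := fun n => moment w (2 * n) / (n.factorial : ℝ) with hbdef
  have hb : ∀ n, 0 < b n := fun n => div_pos (hpos _) (hfac n)
  have hb1 : ∀ n, b n ≤ 1 := by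
    intro n
    rw [hbdef, div_le_one (hfac n)]
    have h1 : (1 : ℝ) ≤ n.factorial := by exact_mod_cast n.factorial_pos
    exact (moment_le_moment_zero hw_nonneg hw_int _).trans (h0.le.trans h1)
  have hratio : ∀ n, b (n + 1) / b n =
      moment w (2 * (n + 1)) / moment w (2 * n) / ((n : ℝ) + 1) := by
    intro n
    have := (hfac n).ne'
    have := (hpos (2 * n)).ne'
    simp only [hbdef, Nat.factorial_succ]
    push_cast
    field_simp
  have hr : Antitone fun n => b (n + 1) / b n := by
    refine antitone_nat_of_succ_le fun n => ?_
    have hc := hcond (n + 1) (by omega)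
    simp only [add_tsub_cancel_right] at hc
    have hp : 0 ≤ moment w (2 * (n + 1 + 1)) /
        (((n + 1 : ℕ) + 1) * moment w (2 * n)) :=
      div_nonneg (hpos _).le (mul_nonneg (by positivity) (hpos _).le)
    rw [hratio, hratio, le_div_iff₀ (by positivity)]
    refine le_trans (le_of_eq ?_) ((le_add_of_nonneg_left hp).trans hc)
    push_cast
    ring
  have h := egf_le_rpow hb hb1 (by simp [hbdef, h0]) hr hq
  have hegf : ∀ t : ℝ, egf b t =
      ∑' n : ℕ, t ^ n * moment w (2 * n) / (Nat.factorial n : ℝ) ^ 2 := by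
    intro t
    refine tsum_congr fun n => ?_
    have := (hfac n).ne'
    simp only [hbdef]
    field_simp
  rw [hegf, hegf] at h
  simpa using h
end

section
/- Let h_{2n} = (1 + 4^{-n})/(2(2n+1)) for n ≥ 0 (the even moments of the weight w*(ρ) = 3/(2ρ) on [0,1/2], 1/(2ρ) on (1/2,1]), and set S = ∑_{n=0}^∞ h_{2n}/(n!)². Then ∑_{n=0}^∞ h_{2(n+1)}/((n!)²(n+1)) > S·ln S; consequently the function ψ(q) = ∑_{n=0}^∞ q^n h_{2n}/(n!)² − (∑_{n=0}^∞ h_{2n}/(n!)²)^q satisfies ψ(1) = 0 and ψ'(1) > 0, so there exists ε > 0 such that ∑_{n=0}^∞ q^n h_{2n}/(n!)² > (∑_{n=0}^∞ h_{2n}/(n!)²)^q for all q ∈ (1, 1+ε). -/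
/-- The even moments `h_{2n} = (1 + 4⁻ⁿ)/(2(2n+1))` of the weight
`w*(ρ) = 3/(2ρ)` on `[0,1/2]`, `1/(2ρ)` on `(1/2,1]`. -/
noncomputable def hstar (n : ℕ) : ℝ := (1 + ((1:ℝ) / 4) ^ n) / (2 * (2 * n + 1))

/-- `ψ(q) = ∑ qⁿ h_{2n}/(n!)² − (∑ h_{2n}/(n!)²)^q`. -/
noncomputable def psiStar (q : ℝ) : ℝ :=
  (∑' n : ℕ, q ^ n * hstar n / (Nat.factorial n : ℝ) ^ 2) -
    (∑' n : ℕ, hstar n / (Nat.factorial n : ℝ) ^ 2) ^ q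

lemma hstar_pos (n : ℕ) : 0 < hstar n := by
  unfold hstar
  positivity

lemma hstar_le_inv (n : ℕ) : hstar n ≤ 1 / (2 * n + 1) := by
  have h : ((1 : ℝ) / 4) ^ n ≤ 1 := pow_le_one₀ (by norm_num) (by norm_num)
  rw [hstar, div_le_div_iff₀ (by positivity) (by positivity)]
  nlinarith [Nat.cast_nonneg (α := ℝ) n]

lemma hstar_le_one (n : ℕ) : hstar n ≤ 1 :=
  (hstar_le_inv n).trans <| (div_le_one (by positivity)).2 <| by
    linarith [Nat.cast_nonneg (α := ℝ) n]

lemma one_le_factorial_cast (n : ℕ) : (1 : ℝ) ≤ (n.factorial : ℝ) := by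
  exact_mod_cast n.factorial_pos

lemma summable_hstar_div : Summable fun n : ℕ => hstar n / (n.factorial : ℝ) ^ 2 := by
  refine .of_nonneg_of_le (fun n => div_nonneg (hstar_pos n).le (by positivity)) (fun n => ?_)
    (Real.summable_pow_div_factorial 1)
  rw [one_pow]
  have h := one_le_factorial_cast n
  gcongr
  · exact hstar_le_one n
  · nlinarith

lemma norm_deriv_term_le (n : ℕ) {q : ℝ} (hq : q ∈ Set.Ioo (-2 : ℝ) 2) :
    ‖(n : ℝ) * q ^ (n - 1) * hstar n / (n.factorial : ℝ) ^ 2‖ ≤ 2 ^ n / (n.factorial : ℝ) := by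
  have hq' : |q| ≤ 2 := (abs_lt.2 hq).le
  have h1 : |q| ^ (n - 1) ≤ 2 ^ n :=
    (pow_le_pow_left₀ (abs_nonneg q) hq' _).trans
      (pow_le_pow_right₀ (by norm_num) (Nat.sub_le n 1))
  have hn : (n : ℝ) ≤ n.factorial := by exact_mod_cast n.self_le_factorial
  have hf : (0 : ℝ) < n.factorial := by positivity
  rw [Real.norm_eq_abs, abs_div, abs_mul, abs_mul, abs_pow, Nat.abs_cast,
    abs_of_pos (hstar_pos n), abs_of_pos (pow_pos hf 2)]
  calc (n : ℝ) * |q| ^ (n - 1) * hstar n / (n.factorial : ℝ) ^ 2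
      ≤ n.factorial * 2 ^ n * 1 / (n.factorial : ℝ) ^ 2 := by
        have := hstar_le_one n
        have := (hstar_pos n).le
        gcongr
    _ = 2 ^ n / (n.factorial : ℝ) := by
        field_simp

/-- Termwise differentiation of the power series with coefficients `h_{2n}/(n!)²`. -/
lemma hasDerivAt_tsum_pow_mul_hstar :
    HasDerivAt (fun q : ℝ => ∑' n : ℕ, q ^ n * hstar n / (n.factorial : ℝ) ^ 2)
      (∑' n : ℕ, hstar (n + 1) / ((n.factorial : ℝ) ^ 2 * (n + 1))) 1 := by
  have hmem : (1 : ℝ) ∈ Set.Ioo (-2 : ℝ) 2 := by norm_num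
  have hu := Real.summable_pow_div_factorial 2
  have key := hasDerivAt_tsum_of_isPreconnected
    (g := fun (n : ℕ) (q : ℝ) => q ^ n * hstar n / (n.factorial : ℝ) ^ 2)
    (g' := fun (n : ℕ) (q : ℝ) => (n : ℝ) * q ^ (n - 1) * hstar n / (n.factorial : ℝ) ^ 2)
    hu isOpen_Ioo isPreconnected_Ioo
    (fun n q _ => ((hasDerivAt_pow n q).mul_const _).div_const _)
    (fun n q hq => norm_deriv_term_le n hq) hmem
    (by simpa using summable_hstar_div) hmem
  suffices h : (∑' n : ℕ, (n : ℝ) * 1 ^ (n - 1) * hstar n / (n.factorial : ℝ) ^ 2) =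
      ∑' n : ℕ, hstar (n + 1) / ((n.factorial : ℝ) ^ 2 * (n + 1)) from h ▸ key
  rw [(Summable.of_norm_bounded hu fun n => norm_deriv_term_le n hmem).tsum_eq_zero_add]
  simp only [Nat.cast_zero, zero_mul, zero_div, zero_add, one_pow, mul_one]
  refine tsum_congr fun n => ?_
  rw [Nat.factorial_succ]
  push_cast
  have : (n.factorial : ℝ) ≠ 0 := by positivity
  field_simp

lemma one_le_tsum_hstar : 1 ≤ ∑' n : ℕ, hstar n / (n.factorial : ℝ) ^ 2 := by
  have h := summable_hstar_div.sum_le_tsum (Finset.range 1)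
    fun n _ => div_nonneg (hstar_pos n).le (by positivity)
  norm_num [Finset.sum_range_succ, hstar] at h
  simpa [hstar] using h

lemma tsum_hstar_le : ∑' n : ℕ, hstar n / (n.factorial : ℝ) ^ 2 ≤ 1.2375 := by
  have htail : ∑' n : ℕ, hstar (n + 4) / ((n + 4).factorial : ℝ) ^ 2 ≤ 1 / 5184 * 2 := by
    rw [← tsum_geometric_two, ← tsum_mul_left]
    refine Summable.tsum_le_tsum (fun n => ?_)
      ((summable_nat_add_iff (f := fun n : ℕ => hstar n / (n.factorial : ℝ) ^ 2) 4).2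
        summable_hstar_div) (summable_geometric_two.mul_left _)
    have h1 : hstar (n + 4) ≤ 1 / 9 := (hstar_le_inv _).trans <| by
      push_cast
      gcongr
      linarith [Nat.cast_nonneg (α := ℝ) n]
    have h2 : (24 * 2 ^ n : ℝ) ≤ (n + 4).factorial := by
      have h := Nat.factorial_mul_pow_le_factorial (m := 4) (n := n)
      rw [add_comm 4 n] at h
      have h' : 24 * 2 ^ n ≤ (n + 4).factorial :=
        (Nat.mul_le_mul_left 24 (Nat.pow_le_pow_left (by norm_num) n)).trans h
      exact_mod_cast h'
    have h3 : (1 : ℝ) ≤ 2 ^ n := one_le_pow₀ (by norm_num)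
    calc hstar (n + 4) / ((n + 4).factorial : ℝ) ^ 2
        ≤ 1 / 9 / (576 * 2 ^ n) := by
          gcongr
          nlinarith
      _ = 1 / 5184 * (1 / 2) ^ n := by
          rw [div_pow, one_pow]
          field_simp
          norm_num
  rw [← summable_hstar_div.sum_add_tsum_nat_add 4]
  have hhead : ∑ n ∈ Finset.range 4, hstar n / (n.factorial : ℝ) ^ 2 ≤ 1.23692 := by
    norm_num [Finset.sum_range_succ, hstar, Nat.factorial]
  linarith

lemma log_le_of_le {x : ℝ} (h0 : 0 < x) (hx : x ≤ 1.2375) : Real.log x ≤ 0.215 := by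
  rw [Real.log_le_iff_le_exp h0]
  have h := Real.sum_le_exp_of_nonneg (x := 0.215) (by norm_num) 4
  norm_num [Finset.sum_range_succ, Nat.factorial] at h hx ⊢
  linarith

lemma le_tsum_hstar_succ :
    0.267 ≤ ∑' n : ℕ, hstar (n + 1) / ((n.factorial : ℝ) ^ 2 * (n + 1)) := by
  have hnn (n : ℕ) : 0 ≤ hstar (n + 1) / ((n.factorial : ℝ) ^ 2 * (n + 1)) :=
    div_nonneg (hstar_pos _).le (by positivity)
  have hsum : Summable fun n : ℕ => hstar (n + 1) / ((n.factorial : ℝ) ^ 2 * (n + 1)) := by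
    refine .of_nonneg_of_le hnn (fun n => ?_) (Real.summable_pow_div_factorial 1)
    rw [one_pow]
    have h := one_le_factorial_cast n
    have hn := Nat.cast_nonneg (α := ℝ) n
    gcongr
    · exact hstar_le_one _
    · nlinarith [mul_nonneg (sq_nonneg (n.factorial : ℝ)) hn]
  refine le_trans ?_ (hsum.sum_le_tsum (Finset.range 3) fun n _ => hnn n)
  norm_num [Finset.sum_range_succ, hstar, Nat.factorial]

lemma tsum_hstar_mul_log_lt :
    (∑' n : ℕ, hstar n / (n.factorial : ℝ) ^ 2) *
      Real.log (∑' n : ℕ, hstar n / (n.factorial : ℝ) ^ 2) <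
    ∑' n : ℕ, hstar (n + 1) / ((n.factorial : ℝ) ^ 2 * (n + 1)) := by
  have h1 := one_le_tsum_hstar
  have h2 := tsum_hstar_le
  have h3 := log_le_of_le (by linarith) h2
  refine lt_of_lt_of_le ?_ le_tsum_hstar_succ
  refine lt_of_le_of_lt (mul_le_mul h2 h3 (Real.log_nonneg h1) (by norm_num)) (by norm_num)

/-- A function vanishing at `a` with positive derivative there is positive just to the right. -/
lemma HasDerivAt.exists_forall_pos_right {f : ℝ → ℝ} {f' a : ℝ} (hf : HasDerivAt f f' a)
    (ha : f a = 0) (hf' : 0 < f') : ∃ ε : ℝ, 0 < ε ∧ ∀ x : ℝ, a < x → x < a + ε → 0 < f x := by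
  have h := (hasDerivAt_iff_tendsto_slope.1 hf).eventually (lt_mem_nhds hf')
  rw [eventually_nhdsWithin_iff, Metric.eventually_nhds_iff] at h
  obtain ⟨ε, hε, h⟩ := h
  refine ⟨ε, hε, fun x hax hx => ?_⟩
  have hs := h (y := x) (by rw [Real.dist_eq, abs_lt]; constructor <;> linarith) hax.ne'
  rw [slope_def_field, ha, sub_zero] at hs
  exact (div_pos_iff_of_pos_right (sub_pos.2 hax)).1 hs


/-- For the moments of the weight `w*`, with `S = ∑ h_{2n}/(n!)²`, one has
`∑ h_{2(n+1)}/((n!)²(n+1)) > S·ln S`; consequently `ψ(1) = 0` and `ψ'(1) > 0`,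
so there is `ε > 0` with `∑ qⁿ h_{2n}/(n!)² > (∑ h_{2n}/(n!)²)^q` for all
`q ∈ (1, 1+ε)`. -/
theorem wstar_derivative_positive :
    (∑' n : ℕ, hstar (n + 1) / ((Nat.factorial n : ℝ) ^ 2 * (n + 1))) >
      (∑' n : ℕ, hstar n / (Nat.factorial n : ℝ) ^ 2) *
        Real.log (∑' n : ℕ, hstar n / (Nat.factorial n : ℝ) ^ 2) ∧
    psiStar 1 = 0 ∧
    HasDerivAt psiStar
      ((∑' n : ℕ, hstar (n + 1) / ((Nat.factorial n : ℝ) ^ 2 * (n + 1))) -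
        (∑' n : ℕ, hstar n / (Nat.factorial n : ℝ) ^ 2) *
          Real.log (∑' n : ℕ, hstar n / (Nat.factorial n : ℝ) ^ 2)) 1 ∧
    ∃ ε : ℝ, 0 < ε ∧ ∀ q : ℝ, 1 < q → q < 1 + ε →
      (∑' n : ℕ, q ^ n * hstar n / (Nat.factorial n : ℝ) ^ 2) >
        (∑' n : ℕ, hstar n / (Nat.factorial n : ℝ) ^ 2) ^ q := by
  have hpsi : psiStar 1 = 0 := by simp [psiStar]
  have hderiv := hasDerivAt_tsum_pow_mul_hstar.sub
    (Real.hasStrictDerivAt_const_rpow (lt_of_lt_of_le one_pos one_le_tsum_hstar) 1).hasDerivAt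
  rw [Real.rpow_one] at hderiv
  refine ⟨tsum_hstar_mul_log_lt, hpsi, hderiv, ?_⟩
  obtain ⟨ε, hε, h⟩ := HasDerivAt.exists_forall_pos_right (f := psiStar) hderiv hpsi
    (sub_pos.2 tsum_hstar_mul_log_lt)
  exact ⟨ε, hε, fun q h1 h2 => sub_pos.1 (h q h1 h2)⟩
end

section
/- Let (g_n)_{n≥0} be a sequence of real numbers with g_0 = 1, 0 < g_n ≤ g_{n-1} for all n ≥ 1, and g_n/g_{n-1} ≥ (n/(n+1))·g_{n+1}/g_n for all n ≥ 1. Then for every integer n ≥ 0, ∑_{k=0}^{n} g_{n-k}·g_{k+2} / (((n-k)!)²·(k!)²·(k+1)·(k+2)) ≤ ∑_{k=0}^{n} g_{n-k+1}·g_{k+1} / (((n-k)!)²·(k!)²·(n-k+1)·(k+1)). -/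
open Finset in
/-- Weighted Chebyshev sum inequality for similarly ordered functions. -/
theorem sum_mul_sum_le_sum_mul_sum_of_similarly_ordered {ι : Type*} (t : Finset ι)
    (w f h : ι → ℝ) (hw : ∀ i ∈ t, 0 ≤ w i)
    (hfh : ∀ i ∈ t, ∀ j ∈ t, 0 ≤ (f i - f j) * (h i - h j)) :
    (∑ i ∈ t, w i * f i) * (∑ i ∈ t, w i * h i) ≤
      (∑ i ∈ t, w i) * ∑ i ∈ t, w i * (f i * h i) := by
  have key : 0 ≤ ∑ i ∈ t, ∑ j ∈ t, w i * w j * ((f i - f j) * (h i - h j)) :=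
    sum_nonneg fun i hi => sum_nonneg fun j hj =>
      mul_nonneg (mul_nonneg (hw i hi) (hw j hj)) (hfh i hi j hj)
  have expand : ∑ i ∈ t, ∑ j ∈ t, w i * w j * ((f i - f j) * (h i - h j)) =
      (∑ i ∈ t, w i * (f i * h i)) * (∑ j ∈ t, w j)
        - (∑ i ∈ t, w i * f i) * (∑ j ∈ t, w j * h j)
        - (∑ i ∈ t, w i * h i) * (∑ j ∈ t, w j * f j)
        + (∑ i ∈ t, w i) * (∑ j ∈ t, w j * (f j * h j)) := by
    simp only [sum_mul_sum, ← sum_sub_distrib, ← sum_add_distrib]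
    exact sum_congr rfl fun i _ => sum_congr rfl fun j _ => by ring
  rw [expand] at key
  linarith [mul_comm (∑ i ∈ t, w i * f i) (∑ i ∈ t, w i * h i),
    mul_comm (∑ i ∈ t, w i) (∑ i ∈ t, w i * (f i * h i))]

/-- The centred second moment of the binomial coefficients. -/
theorem sum_choose_mul_sub_sq (N : ℕ) :
    ∑ j ∈ Finset.range (N + 1), (N.choose j : ℝ) * ((N : ℝ) - ((N : ℝ) - 2 * j) ^ 2) = 0 := by
  have hvar := congrArg (Polynomial.eval (1 / 2 : ℝ)) (bernsteinPolynomial.variance ℝ N)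
  have htot := congrArg (Polynomial.eval (1 / 2 : ℝ)) (bernsteinPolynomial.sum ℝ N)
  simp only [Polynomial.eval_finsetSum, bernsteinPolynomial, Polynomial.eval_mul,
    Polynomial.eval_pow, Polynomial.eval_sub, Polynomial.eval_X,
    Polynomial.eval_natCast, Polynomial.eval_one, nsmul_eq_mul] at hvar htot
  have hhalf : ∀ j ∈ Finset.range (N + 1),
      (N.choose j : ℝ) * ((N : ℝ) - ((N : ℝ) - 2 * j) ^ 2) =
        2 ^ N * ((N : ℝ) * ((N.choose j : ℝ) * (1 / 2) ^ j * (1 - 1 / 2) ^ (N - j))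
          - 4 * (((N : ℝ) * (1 / 2) - j) ^ 2 *
            ((N.choose j : ℝ) * (1 / 2) ^ j * (1 - 1 / 2) ^ (N - j)))) := by
    intro j hj
    have hpow : (2 : ℝ) ^ N * ((1 / 2) ^ j * (1 - 1 / 2) ^ (N - j)) = 1 := by
      rw [show (1 : ℝ) - 1 / 2 = 1 / 2 by norm_num, ← pow_add,
        Nat.add_sub_of_le (Finset.mem_range_succ_iff.mp hj), ← mul_pow]
      norm_num
    linear_combination
      (-(N.choose j : ℝ) * ((N : ℝ) - ((N : ℝ) - 2 * j) ^ 2)) * hpow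
  rw [Finset.sum_congr rfl hhalf, ← Finset.mul_sum, Finset.sum_sub_distrib, ← Finset.mul_sum,
    ← Finset.mul_sum, hvar, htot]
  ring

theorem mul_succ_le_succ_mul_of_logConcave {s : ℕ → ℝ} (hpos : ∀ n, 0 < s n)
    (hlc : ∀ n, s n * s (n + 2) ≤ s (n + 1) ^ 2) {a b : ℕ} (hab : a ≤ b) :
    s a * s (b + 1) ≤ s (a + 1) * s b := by
  have hanti : Antitone fun n => s (n + 1) / s n := by
    refine antitone_nat_of_succ_le fun n => ?_
    rw [div_le_div_iff₀ (hpos _) (hpos _)]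
    linarith [hlc n]
  have := hanti hab
  rw [div_le_div_iff₀ (hpos _) (hpos _)] at this
  linarith

theorem mul_add_le_add_mul_of_logConcave {s : ℕ → ℝ} (hpos : ∀ n, 0 < s n)
    (hlc : ∀ n, s n * s (n + 2) ≤ s (n + 1) ^ 2) (a d k : ℕ) (h : a + k ≤ d) :
    s a * s (d + k) ≤ s (a + k) * s d := by
  induction k generalizing d with
  | zero => simp
  | succ k ih =>
    calc s a * s (d + (k + 1)) = s a * s (d + 1 + k) := by rw [add_right_comm, add_assoc]
      _ ≤ s (a + k) * s (d + 1) := ih (d + 1) (by omega)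
      _ ≤ s (a + (k + 1)) * s d := mul_succ_le_succ_mul_of_logConcave hpos hlc (by omega)

/-- For a log-concave sequence, `s i * s (N - i)` increases as `i` approaches `N / 2`. -/
theorem mul_reflect_le_of_logConcave {s : ℕ → ℝ} (hpos : ∀ n, 0 < s n)
    (hlc : ∀ n, s n * s (n + 2) ≤ s (n + 1) ^ 2) {N i j : ℕ} (hi : i ≤ N) (hj : j ≤ N)
    (hij : ((N : ℝ) - 2 * j) ^ 2 < ((N : ℝ) - 2 * i) ^ 2) :
    s i * s (N - i) ≤ s j * s (N - j) := by
  have key : ∀ a b c d : ℕ, a ≤ c → c ≤ d → a + b = c + d → s a * s b ≤ s c * s d := by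
    intro a b c d hac hcd hsum
    obtain ⟨k, rfl⟩ := Nat.exists_eq_add_of_le hac
    obtain rfl : b = d + k := by omega
    exact mul_add_le_add_mul_of_logConcave hpos hlc a d k hcd
  obtain ⟨p, rfl⟩ := Nat.exists_eq_add_of_le hi
  obtain ⟨q, hq⟩ := Nat.exists_eq_add_of_le hj
  have hqR : ((i : ℝ) + p) = j + q := by exact_mod_cast hq
  rw [Nat.add_sub_cancel_left, show i + p - j = q by omega]
  have habs : ((j : ℤ) - q).natAbs < ((i : ℤ) - p).natAbs := by
    rw [Int.natAbs_lt_iff_sq_lt]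
    have : ((j : ℝ) - q) ^ 2 < ((i : ℝ) - p) ^ 2 := by
      push_cast at hij
      convert hij using 1
      · rw [hqR]; ring
      · ring
    exact_mod_cast this
  rcases le_total i p with hip | hip <;> rcases le_total j q with hjq | hjq
  · exact key i p j q (by omega) hjq hq
  · rw [mul_comm (s j)]; exact key i p q j (by omega) hjq (by omega)
  · rw [mul_comm (s i)]; exact key p i j q (by omega) hjq (by omega)
  · rw [mul_comm (s i), mul_comm (s j)]; exact key p i q j (by omega) hjq (by omega)

theorem sum_choose_mul_logConcave_nonneg {s : ℕ → ℝ} (hpos : ∀ n, 0 < s n)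
    (hlc : ∀ n, s n * s (n + 2) ≤ s (n + 1) ^ 2) (N : ℕ) :
    0 ≤ ∑ j ∈ Finset.range (N + 1),
      (N.choose j : ℝ) * (((N : ℝ) - ((N : ℝ) - 2 * j) ^ 2) * (s j * s (N - j))) := by
  have hcheb := sum_mul_sum_le_sum_mul_sum_of_similarly_ordered (Finset.range (N + 1))
    (fun j => (N.choose j : ℝ)) (fun j => (N : ℝ) - ((N : ℝ) - 2 * j) ^ 2)
    (fun j => s j * s (N - j)) (fun _ _ => Nat.cast_nonneg _) ?_
  · rw [sum_choose_mul_sub_sq, zero_mul] at hcheb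
    refine nonneg_of_mul_nonneg_right hcheb (Finset.sum_pos' (fun _ _ => Nat.cast_nonneg _) ?_)
    exact ⟨0, by simp, by simp⟩
  · intro i hi j hj
    rw [Finset.mem_range_succ_iff] at hi hj
    rcases lt_trichotomy (((N : ℝ) - 2 * j) ^ 2) (((N : ℝ) - 2 * i) ^ 2) with h | h | h
    · have := mul_reflect_le_of_logConcave hpos hlc hi hj h
      exact mul_nonneg_of_nonpos_of_nonpos (by linarith) (by linarith)
    · simp [h]
    · have := mul_reflect_le_of_logConcave hpos hlc hj hi h
      exact mul_nonneg (by linarith) (by linarith)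

/-- Reflecting `m ↦ N - m` turns the comparison of the two weights `m (m - 1)` and `m (N - m)`
into nonnegativity of a centred second moment. -/
theorem sum_choose_mul_falling_le {s : ℕ → ℝ} (hpos : ∀ n, 0 < s n)
    (hlc : ∀ n, s n * s (n + 2) ≤ s (n + 1) ^ 2) (N : ℕ) :
    ∑ m ∈ Finset.range (N + 1), (N.choose m : ℝ) * (s m * s (N - m)) * (m * ((m : ℝ) - 1)) ≤
      ∑ m ∈ Finset.range (N + 1),
        (N.choose m : ℝ) * (s m * s (N - m)) * (m * ((N : ℝ) - m)) := by
  have hrefl : ∑ m ∈ Finset.range (N + 1),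
        (N.choose m : ℝ) * (s m * s (N - m)) * (m * ((m : ℝ) - 1)) =
      ∑ m ∈ Finset.range (N + 1),
        (N.choose m : ℝ) * (s m * s (N - m)) * (((N : ℝ) - m) * ((N : ℝ) - m - 1)) := by
    rw [← Finset.sum_range_reflect]
    refine Finset.sum_congr rfl fun m hm => ?_
    have hm' := Finset.mem_range_succ_iff.mp hm
    rw [Nat.add_sub_cancel, Nat.choose_symm hm', Nat.sub_sub_self hm', Nat.cast_sub hm',
      mul_comm (s (N - m))]
  have hdiff : ∑ m ∈ Finset.range (N + 1),
        (N.choose m : ℝ) * (((N : ℝ) - ((N : ℝ) - 2 * m) ^ 2) * (s m * s (N - m))) =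
      2 * (∑ m ∈ Finset.range (N + 1),
        (N.choose m : ℝ) * (s m * s (N - m)) * (m * ((N : ℝ) - m)))
      - (∑ m ∈ Finset.range (N + 1),
        (N.choose m : ℝ) * (s m * s (N - m)) * (m * ((m : ℝ) - 1)))
      - ∑ m ∈ Finset.range (N + 1),
        (N.choose m : ℝ) * (s m * s (N - m)) * (((N : ℝ) - m) * ((N : ℝ) - m - 1)) := by
    simp only [Finset.mul_sum, ← Finset.sum_sub_distrib]
    exact Finset.sum_congr rfl fun m _ => by ring
  have := sum_choose_mul_logConcave_nonneg hpos hlc N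
  rw [hdiff, ← hrefl] at this
  linarith


/-- **Lemma 1.** If `(g_n)` is positive, nonincreasing, `g₀ = 1`, and
`g_n/g_{n-1} ≥ (n/(n+1))·g_{n+1}/g_n` for `n ≥ 1`, then for all `n ≥ 0`,
`∑_{k=0}^{n} g_{n-k} g_{k+2}/(((n-k)!)²(k!)²(k+1)(k+2))
  ≤ ∑_{k=0}^{n} g_{n-k+1} g_{k+1}/(((n-k)!)²(k!)²(n-k+1)(k+1))`. -/
theorem lemma_one (g : ℕ → ℝ) (hg0 : g 0 = 1)
    (hgpos : ∀ n : ℕ, 1 ≤ n → 0 < g n)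
    (hgmono : ∀ n : ℕ, 1 ≤ n → g n ≤ g (n - 1))
    (hcond : ∀ n : ℕ, 1 ≤ n →
      ((n : ℝ) / (n + 1)) * (g (n + 1) / g n) ≤ g n / g (n - 1))
    (n : ℕ) :
    ∑ k ∈ Finset.range (n + 1),
        g (n - k) * g (k + 2) /
          ((Nat.factorial (n - k) : ℝ) ^ 2 * (Nat.factorial k : ℝ) ^ 2 * (k + 1) * (k + 2)) ≤
      ∑ k ∈ Finset.range (n + 1),
        g (n - k + 1) * g (k + 1) /
          ((Nat.factorial (n - k) : ℝ) ^ 2 * (Nat.factorial k : ℝ) ^ 2 *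
            ((n : ℝ) - k + 1) * (k + 1)) := by
  have hpos : ∀ m, 0 < g m
    | 0 => hg0 ▸ one_pos
    | m + 1 => hgpos _ m.succ_pos
  set s : ℕ → ℝ := fun m => g m / (Nat.factorial m : ℝ) with hs
  have hspos : ∀ m, 0 < s m := fun m => div_pos (hpos m) (by positivity)
  have hlc : ∀ m, s m * s (m + 2) ≤ s (m + 1) ^ 2 := by
    intro m
    have hc := hcond (m + 1) m.succ_pos
    have := hpos m
    have := hpos (m + 1)
    rw [Nat.add_sub_cancel, div_mul_div_comm, div_le_div_iff₀ (by positivity) (by positivity)] at hc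
    push_cast at hc
    simp only [hs, Nat.factorial_succ]
    push_cast
    rw [div_mul_div_comm, div_pow, div_le_div_iff₀ (by positivity) (by positivity)]
    have hf : 0 < (Nat.factorial m : ℝ) ^ 2 * (m + 1) := by positivity
    have := mul_le_mul_of_nonneg_left hc hf.le
    linarith
  have hmain := sum_choose_mul_falling_le hspos hlc (n + 2)
  rw [Finset.sum_range_succ' _ (n + 2), Finset.sum_range_succ' _ (n + 1),
    Finset.sum_range_succ _ (n + 2), Finset.sum_range_succ' _ (n + 1)] at hmain
  simp only [Nat.cast_zero, zero_mul, mul_zero, add_zero, zero_add, Nat.cast_one, sub_self]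
    at hmain
  have hN : 0 < (Nat.factorial (n + 2) : ℝ) := by positivity
  refine le_of_mul_le_mul_left ?_ hN
  rw [Finset.mul_sum, Finset.mul_sum]
  refine Eq.trans_le ?_ (hmain.trans_eq ?_)
  · refine Finset.sum_congr rfl fun k hk => ?_
    obtain ⟨p, rfl⟩ := Nat.exists_eq_add_of_le (Finset.mem_range_succ_iff.mp hk)
    rw [show k + p - k = p by omega, show k + 1 + 1 = k + 2 from rfl,
      show k + p + 2 - (k + 2) = p by omega,
      Nat.cast_choose ℝ (by omega : k + 2 ≤ k + p + 2), show k + p + 2 - (k + 2) = p by omega]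
    simp only [hs, Nat.factorial_succ k, Nat.factorial_succ (k + 1)]
    push_cast
    field_simp
    ring
  · refine Finset.sum_congr rfl fun k hk => ?_
    obtain ⟨p, rfl⟩ := Nat.exists_eq_add_of_le (Finset.mem_range_succ_iff.mp hk)
    have hcast : ((k + p : ℕ) : ℝ) - k + 1 = p + 1 := by push_cast; ring
    have hcast' : ((k + p + 2 : ℕ) : ℝ) - (k + 1 : ℕ) = p + 1 := by push_cast; ring
    rw [hcast, hcast', show k + p - k = p by omega,
      Nat.cast_choose ℝ (by omega : k + 1 ≤ k + p + 2),
      show k + p + 2 - (k + 1) = p + 1 by omega]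
    simp only [hs, Nat.factorial_succ k, Nat.factorial_succ p]
    push_cast
    field_simp
end

section
/- Let (g_n)_{n≥0} be a sequence of positive real numbers with g_0 = 1 satisfying g_n/g_{n-1} ≥ (n/(n+1))·g_{n+1}/g_n for all n ≥ 1. Then for every integer n ≥ 1 and all nonnegative integers j_1, …, j_n with j_1 + … + j_n = k, one has g_{j_1}·g_{j_2}·…·g_{j_n} ≥ (j_1!·j_2!·…·j_n! / k!)·g_k. -/
/-- A positive sequence with antitone consecutive ratios satisfies
`a (m + l) * a 0 ≤ a m * a l`. -/
lemma add_mul_zero_le_mul_of_antitone_ratio {a : ℕ → ℝ} (hpos : ∀ n, 0 < a n)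
    (hr : Antitone fun n => a (n + 1) / a n) (m l : ℕ) :
    a (m + l) * a 0 ≤ a m * a l := by
  induction l with
  | zero => simp
  | succ l ih =>
    have h1 : a (m + l + 1) / a (m + l) ≤ a (l + 1) / a l := hr (Nat.le_add_left l m)
    calc a (m + l + 1) * a 0
        = a (m + l + 1) / a (m + l) * (a (m + l) * a 0) := by
          have := (hpos (m + l)).ne'
          field_simp
      _ ≤ a (l + 1) / a l * (a m * a l) :=
          mul_le_mul h1 ih (mul_pos (hpos _) (hpos _)).le (div_pos (hpos _) (hpos _)).le
      _ = a m * a (l + 1) := by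
          have := (hpos l).ne'
          field_simp

/-- A nonnegative submultiplicative sequence with `a 0 = 1` is submultiplicative over
finite sums. -/
lemma apply_sum_le_prod_of_submultiplicative {ι : Type*} {a : ℕ → ℝ} (h0 : a 0 = 1)
    (hnonneg : ∀ n, 0 ≤ a n) (hmul : ∀ m l, a (m + l) ≤ a m * a l)
    (s : Finset ι) (j : ι → ℕ) : a (∑ i ∈ s, j i) ≤ ∏ i ∈ s, a (j i) := by
  classical
  induction s using Finset.induction_on with
  | empty => simp [h0]
  | insert i s hi ih =>
    rw [Finset.sum_insert hi, Finset.prod_insert hi]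
    exact (hmul _ _).trans (mul_le_mul_of_nonneg_left ih (hnonneg _))

/-- The ratios of `g n / n!` are antitone when
`(n / (n + 1)) * (g (n + 1) / g n) ≤ g n / g (n - 1)`. -/
lemma antitone_ratio_div_factorial {g : ℕ → ℝ}
    (hcond : ∀ n : ℕ, 1 ≤ n →
      ((n : ℝ) / (n + 1)) * (g (n + 1) / g n) ≤ g n / g (n - 1)) :
    Antitone fun n => (g (n + 1) / (n + 1).factorial) / (g n / n.factorial) := by
  have hratio : ∀ n : ℕ, (g (n + 1) / (n + 1).factorial) / (g n / n.factorial) =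
      (g (n + 1) / g n) / (n + 1) := by
    intro n
    have hf : (n.factorial : ℝ) ≠ 0 := by positivity
    rw [Nat.factorial_succ]
    push_cast
    field_simp
  refine antitone_nat_of_succ_le fun n => ?_
  rw [hratio, hratio, le_div_iff₀ (by positivity)]
  have h := hcond (n + 1) (Nat.le_add_left 1 n)
  rw [Nat.add_sub_cancel] at h
  refine le_of_eq_of_le ?_ h
  push_cast
  ring

/-- Product estimate for a positive sequence `g` with `g₀ = 1` satisfying
`g_n/g_{n-1} ≥ (n/(n+1))·g_{n+1}/g_n`: for `j₁ + … + j_n = k`,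
`g_{j₁}·…·g_{j_n} ≥ (j₁!·…·j_n!/k!)·g_k`. -/
theorem product_moment_estimate (g : ℕ → ℝ) (hg0 : g 0 = 1)
    (hgpos : ∀ n : ℕ, 0 < g n)
    (hcond : ∀ n : ℕ, 1 ≤ n →
      ((n : ℝ) / (n + 1)) * (g (n + 1) / g n) ≤ g n / g (n - 1))
    (n : ℕ) (hn : 1 ≤ n) (k : ℕ) (j : Fin n → ℕ) (hj : ∑ i, j i = k) :
    ((∏ i, Nat.factorial (j i) : ℕ) : ℝ) / (Nat.factorial k : ℝ) * g k ≤
      ∏ i, g (j i) := by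
  have hmul : ∀ m l, g (m + l) / (m + l).factorial ≤
      g m / m.factorial * (g l / l.factorial) := by
    intro m l
    simpa [hg0] using add_mul_zero_le_mul_of_antitone_ratio
      (a := fun n => g n / n.factorial)
      (fun n => div_pos (hgpos n) (by positivity)) (antitone_ratio_div_factorial hcond) m l
  have h := apply_sum_le_prod_of_submultiplicative (a := fun n => g n / n.factorial)
    (by simp [hg0]) (fun n => div_nonneg (hgpos n).le (by positivity)) hmul Finset.univ j
  rw [hj, Finset.prod_div_distrib, le_div_iff₀ (by positivity)] at h
  refine le_of_eq_of_le ?_ h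
  push_cast
  ring
end

section
/- Let (g_n)_{n≥0} be a sequence of positive real numbers with g_0 = 1 satisfying g_n/g_{n-1} ≥ (n/(n+1))·g_{n+1}/g_n for all n ≥ 1. Then for every integer n ≥ 1 and every integer k ≥ 0, ∑_{j_1+…+j_n=k} 1/(g_{j_1}·g_{j_2}·…·g_{j_n}) ≤ n^k / g_k, where the sum is over all n-tuples of nonnegative integers summing to k. -/
/-- A positive log-concave sequence with initial value `1` is submultiplicative. -/
theorem le_mul_of_logConcave (a : ℕ → ℝ) (h0 : a 0 = 1) (hpos : ∀ n, 0 < a n)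
    (hlog : ∀ n, a (n + 2) * a n ≤ a (n + 1) ^ 2) (m l : ℕ) :
    a (m + l) ≤ a m * a l := by
  have hanti : Antitone fun n => a (n + 1) / a n := by
    refine antitone_nat_of_succ_le fun n => ?_
    rw [div_le_div_iff₀ (hpos _) (hpos _), ← sq]
    exact hlog n
  induction l with
  | zero => simp [h0]
  | succ l ih =>
    calc a (m + l + 1) = a (m + l + 1) / a (m + l) * a (m + l) :=
          (div_mul_cancel₀ _ (hpos _).ne').symm
      _ ≤ a (l + 1) / a l * (a m * a l) :=
          mul_le_mul (hanti (Nat.le_add_left l m)) ih (hpos _).le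
            (div_pos (hpos _) (hpos _)).le
      _ = a m * a (l + 1) := by
          have := (hpos l).ne'
          field_simp

theorem le_choose_mul_mul (g : ℕ → ℝ) (hg0 : g 0 = 1) (hgpos : ∀ n : ℕ, 0 < g n)
    (hcond : ∀ n : ℕ, 1 ≤ n →
      ((n : ℝ) / (n + 1)) * (g (n + 1) / g n) ≤ g n / g (n - 1)) (m l : ℕ) :
    g (m + l) ≤ (m + l).choose m * (g m * g l) := by
  have hfac (n : ℕ) : (0 : ℝ) < n.factorial := by positivity
  have h := le_mul_of_logConcave (fun n => g n / n.factorial) (by simp [hg0])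
    (fun n => div_pos (hgpos n) (hfac n)) (fun n => ?_) m l
  · rw [Nat.cast_add_choose]
    have h' : g (m + l) / (m + l).factorial ≤
      g m / m.factorial * (g l / l.factorial) := h
    rw [div_le_iff₀ (hfac _)] at h'
    exact h'.trans_eq (by ring)
  · have h := hcond (n + 1) (by simp)
    rw [Nat.add_sub_cancel, div_mul_div_comm, div_le_div_iff₀
      (mul_pos (by positivity) (hgpos _)) (hgpos _)] at h
    push_cast [Nat.factorial_succ] at h ⊢
    have := hfac n
    rw [div_mul_div_comm, div_pow, div_le_div_iff₀ (by positivity) (by positivity)]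
    have h2 := mul_le_mul_of_nonneg_left h
      (by positivity : (0 : ℝ) ≤ (n + 1) * (n.factorial : ℝ) ^ 2)
    linarith

/-- Key combinatorial estimate: for a positive sequence `g` with `g₀ = 1` satisfying
`g_n/g_{n-1} ≥ (n/(n+1))·g_{n+1}/g_n` for `n ≥ 1`, one has
`∑_{j₁+…+j_n=k} 1/(g_{j₁}·…·g_{j_n}) ≤ nᵏ/g_k`. -/
theorem sum_reciprocal_products_le (g : ℕ → ℝ) (hg0 : g 0 = 1)
    (hgpos : ∀ n : ℕ, 0 < g n)
    (hcond : ∀ n : ℕ, 1 ≤ n →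
      ((n : ℝ) / (n + 1)) * (g (n + 1) / g n) ≤ g n / g (n - 1))
    (n : ℕ) (hn : 1 ≤ n) (k : ℕ) :
    ∑ j ∈ Finset.Nat.antidiagonalTuple n k, 1 / ∏ i, g (j i) ≤
      (n : ℝ) ^ k / g k := by
  clear hn
  induction n generalizing k with
  | zero => cases k <;> simp [hg0]
  | succ n ih =>
    have hsplit : ∑ j ∈ Finset.Nat.antidiagonalTuple (n + 1) k, 1 / ∏ i, g (j i) =
        ∑ p ∈ Finset.HasAntidiagonal.antidiagonal k, 1 / g p.1 *
          ∑ j ∈ Finset.Nat.antidiagonalTuple n p.2, 1 / ∏ i, g (j i) := by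
      simp_rw [Finset.mul_sum]
      rw [Finset.sum_sigma']
      symm
      refine Finset.sum_bij' (fun x _ => (Fin.cons x.1.1 x.2 : Fin (n + 1) → ℕ))
        (fun j _ => ⟨(j 0, ∑ i, Fin.tail j i), Fin.tail j⟩) ?_ ?_ ?_ ?_ ?_
      · rintro ⟨⟨p, q⟩, j⟩ h
        simp_all [Finset.Nat.mem_antidiagonalTuple, Fin.sum_univ_succ]
      · intro j h
        simp_all [Finset.Nat.mem_antidiagonalTuple, Fin.sum_univ_succ, Fin.tail]
      · rintro ⟨⟨p, q⟩, j⟩ h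
        simp_all [Finset.Nat.mem_antidiagonalTuple]
      · intro j h
        simp
      · rintro ⟨⟨p, q⟩, j⟩ h
        simp [Fin.prod_univ_succ, mul_comm]
    have hpow : ((n + 1 : ℕ) : ℝ) ^ k / g k =
        ∑ p ∈ Finset.HasAntidiagonal.antidiagonal k, (k.choose p.1 : ℝ) * (n : ℝ) ^ p.2 / g k := by
      rw [← Finset.sum_div]
      push_cast
      rw [add_comm, (Commute.all (1 : ℝ) n).add_pow']
      simp
    rw [hsplit, hpow]
    refine Finset.sum_le_sum fun p hp => ?_
    obtain rfl := Finset.HasAntidiagonal.mem_antidiagonal.mp hp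
    have h1 := hgpos p.1
    have h2 := hgpos p.2
    calc _ ≤ 1 / g p.1 * ((n : ℝ) ^ p.2 / g p.2) := by
          gcongr
          exact ih p.2
      _ = (n : ℝ) ^ p.2 / (g p.1 * g p.2) := by field_simp
      _ ≤ _ := by
          rw [div_le_div_iff₀ (by positivity) (hgpos _)]
          have h := mul_le_mul_of_nonneg_left
            (le_choose_mul_mul g hg0 hgpos hcond p.1 p.2)
            (by positivity : (0 : ℝ) ≤ (n : ℝ) ^ p.2)
          linarith
end

section
/- For every real m ≥ 0, the power weight w(ρ) = (m+2)·ρ^m on [0,1) has even moments h_{2n} = ∫₀¹ ρ^{2n+1} w(ρ) dρ = (2+m)/(2+m+2n) (so h_0 = 1), and for every integer n ≥ 1 one has h_{2n}/h_{2(n-1)} − (h_{2(n+1)}/((n+1)·h_{2(n-1)}) + (n/(n+1))·h_{2(n+1)}/h_{2n}) = 2m/((1+n)(2+m+2n)(4+m+2n)) ≥ 0; in particular the condition h_{2n}/h_{2(n-1)} ≥ h_{2(n+1)}/((n+1)·h_{2(n-1)}) + (n/(n+1))·h_{2(n+1)}/h_{2n} holds. -/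
/-- The even moments `h_{2n} = (2+m)/(2+m+2n)` of the power weight `w(ρ) = (m+2)ρ^m`. -/
noncomputable def powerMoment (m : ℝ) (n : ℕ) : ℝ := (2 + m) / (2 + m + 2 * n)

/-- For every real `m ≥ 0`, the power weight `w(ρ) = (m+2)ρ^m` has even moments
`h_{2n} = (2+m)/(2+m+2n)` (so `h₀ = 1`), and
`h_{2n}/h_{2(n-1)} − (h_{2(n+1)}/((n+1)h_{2(n-1)}) + (n/(n+1))·h_{2(n+1)}/h_{2n})
  = 2m/((1+n)(2+m+2n)(4+m+2n)) ≥ 0` for all `n ≥ 1`; in particular condition (4)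
of the paper holds. -/
theorem power_weight_moments (m : ℝ) (hm : 0 ≤ m) :
    (∀ n : ℕ,
      (∫ ρ in (0:ℝ)..1, ρ ^ (2 * n + 1) * ((m + 2) * ρ ^ m)) = powerMoment m n) ∧
    powerMoment m 0 = 1 ∧
    (∀ n : ℕ, 1 ≤ n →
      powerMoment m n / powerMoment m (n - 1) -
          (powerMoment m (n + 1) / ((n + 1) * powerMoment m (n - 1)) +
            ((n : ℝ) / (n + 1)) * (powerMoment m (n + 1) / powerMoment m n)) =
        2 * m / ((1 + n) * (2 + m + 2 * n) * (4 + m + 2 * n)) ∧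
      0 ≤ 2 * m / ((1 + n) * (2 + m + 2 * n) * (4 + m + 2 * n))) := by
  refine ⟨fun n => ?_, ?_, fun n hn => ?_⟩
  · have hn0 : (0 : ℝ) ≤ n := n.cast_nonneg
    have hcongr : (∫ ρ in (0:ℝ)..1, ρ ^ (2 * n + 1) * ((m + 2) * ρ ^ m)) =
        ∫ ρ in (0:ℝ)..1, (m + 2) * ρ ^ (m + ((2 * n + 1 : ℕ) : ℝ)) := by
      refine intervalIntegral.integral_congr_ae (Filter.Eventually.of_forall fun ρ hρ => ?_)
      rw [Set.uIoc_of_le zero_le_one] at hρ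
      rw [Real.rpow_add hρ.1, Real.rpow_natCast]
      ring
    rw [hcongr, intervalIntegral.integral_const_mul,
      integral_rpow (Or.inl (by push_cast; linarith)), Real.one_rpow,
      Real.zero_rpow (by positivity), powerMoment]
    push_cast
    field_simp
    ring
  · have : 2 + m ≠ 0 := by positivity
    simp [powerMoment, this]
  · obtain ⟨k, rfl⟩ := Nat.exists_eq_add_of_le' hn
    refine ⟨?_, by positivity⟩
    simp only [powerMoment, Nat.add_sub_cancel]
    push_cast
    field_simp
    ring
end

section
/- For all real t with 0 ≤ t ≤ 2, one has 16·ln(∑_{m=0}^∞ (t/2)^{2m}/(m!)²) − 4t² + t⁴/4 ≥ 0; equivalently, 16·ln I_0(t) ≥ 4t² − t⁴/4 on [0,2], where I_0 is the modified Bessel function of the first kind of order 0. -/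
/-- The modified Bessel function of the first kind of order 0:
`I₀(t) = ∑ (t/2)^{2m}/(m!)²`. -/
noncomputable def besselI0 (t : ℝ) : ℝ :=
  ∑' m : ℕ, (t / 2) ^ (2 * m) / (Nat.factorial m : ℝ) ^ 2

/-- The power series of `I₀` converges. -/
theorem summable_besselI0 (t : ℝ) :
    Summable fun m : ℕ => (t / 2) ^ (2 * m) / (Nat.factorial m : ℝ) ^ 2 := by
  refine Summable.of_nonneg_of_le (fun m => ?_) (fun m => ?_)
    (Real.summable_pow_div_factorial ((t / 2) ^ 2))
  · rw [pow_mul]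
    positivity
  · rw [pow_mul]
    have h : (1 : ℝ) ≤ Nat.factorial m := by exact_mod_cast Nat.factorial_pos m
    gcongr
    exact le_self_pow₀ h two_ne_zero

/-- The partial sum of order `t ^ 4` of `I₀` is a perfect square. -/
theorem sq_le_besselI0 (t : ℝ) : (1 + t ^ 2 / 8) ^ 2 ≤ besselI0 t := by
  have h := (summable_besselI0 t).sum_le_tsum (Finset.range 3) fun m _ => by
    rw [pow_mul]
    positivity
  refine le_trans (le_of_eq ?_) h
  simp [Finset.sum_range_succ, Nat.factorial]
  ring

theorem sub_sq_div_two_le_log_one_add {y : ℝ} (hy : 0 ≤ y) :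
    y - y ^ 2 / 2 ≤ Real.log (1 + y) := by
  refine le_trans ?_ (Real.le_log_one_add_of_nonneg hy)
  rw [le_div_iff₀ (by positivity)]
  nlinarith [pow_nonneg hy 3]

/-- For all `0 ≤ t ≤ 2`, `16·ln I₀(t) − 4t² + t⁴/4 ≥ 0`, i.e.
`16·ln I₀(t) ≥ 4t² − t⁴/4` on `[0,2]`. -/
theorem bessel_log_inequality (t : ℝ) (ht0 : 0 ≤ t) (ht2 : t ≤ 2) :
    0 ≤ 16 * Real.log (∑' m : ℕ, (t / 2) ^ (2 * m) / (Nat.factorial m : ℝ) ^ 2)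
        - 4 * t ^ 2 + t ^ 4 / 4 ∧
    4 * t ^ 2 - t ^ 4 / 4 ≤ 16 * Real.log (besselI0 t) := by
  have key : 4 * t ^ 2 - t ^ 4 / 4 ≤ 16 * Real.log (besselI0 t) := by
    have hlog := Real.log_le_log (by positivity) (sq_le_besselI0 t)
    rw [Real.log_pow] at hlog
    have hy := sub_sq_div_two_le_log_one_add (y := t ^ 2 / 8) (by positivity)
    push_cast at hlog
    linarith
  refine ⟨?_, key⟩
  rw [besselI0] at key
  linarith
end

section
/- Let w be a Bergman weight with h_0 = 1 whose moments satisfy h_4 ≤ 2h_2²/(1 + h_2) (which follows from the condition h_{2m}/h_{2(m-1)} ≥ h_{2(m+1)}/((m+1)·h_{2(m-1)}) + (m/(m+1))·h_{2(m+1)}/h_{2m} at m = 1). Then h_4/2 ≤ h_2·ln(∑_{k=0}^∞ h_{2k}/(k!)²). -/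
open MeasureTheory

theorem moment_nonneg {w : ℝ → ℝ} (hw : ∀ ρ ∈ Set.Ico (0:ℝ) 1, 0 ≤ w ρ)
    {m : ℕ} (hm : IntervalIntegrable (fun ρ => ρ ^ (m + 1) * w ρ) volume 0 1) :
    0 ≤ moment w m := by
  have h := intervalIntegral.integral_mono_on_of_le_Ioo zero_le_one
    (IntervalIntegrable.zero (μ := volume)) hm fun ρ hρ =>
      mul_nonneg (pow_nonneg hρ.1.le _) (hw ρ (Set.Ioo_subset_Ico_self hρ))
  simpa [moment] using h

theorem moment_le_moment {w : ℝ → ℝ} (hw : ∀ ρ ∈ Set.Ico (0:ℝ) 1, 0 ≤ w ρ)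
    {m n : ℕ} (hm : IntervalIntegrable (fun ρ => ρ ^ (m + 1) * w ρ) volume 0 1)
    (hn : IntervalIntegrable (fun ρ => ρ ^ (n + 1) * w ρ) volume 0 1) (hmn : m ≤ n) :
    moment w n ≤ moment w m :=
  intervalIntegral.integral_mono_on_of_le_Ioo zero_le_one hn hm fun ρ hρ =>
    mul_le_mul_of_nonneg_right
      (pow_le_pow_of_le_one hρ.1.le hρ.2.le (Nat.succ_le_succ hmn))
      (hw ρ (Set.Ioo_subset_Ico_self hρ))

theorem summable_moment_div_factorial_sq {w : ℝ → ℝ}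
    (hw : ∀ ρ ∈ Set.Ico (0:ℝ) 1, 0 ≤ w ρ)
    (hw_int : ∀ m : ℕ, IntervalIntegrable (fun ρ => ρ ^ (m + 1) * w ρ) volume 0 1) :
    Summable fun k : ℕ => moment w (2 * k) / (Nat.factorial k : ℝ) ^ 2 := by
  have hexp : Summable fun k : ℕ => moment w 0 * (1 ^ k / (Nat.factorial k : ℝ)) :=
    (Real.summable_pow_div_factorial 1).mul_left _
  refine hexp.of_nonneg_of_le
    (fun k => div_nonneg (moment_nonneg hw (hw_int _)) (sq_nonneg _)) fun k => ?_
  have hk : (1 : ℝ) ≤ Nat.factorial k := by exact_mod_cast Nat.factorial_pos k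
  rw [one_pow, mul_one_div]
  exact div_le_div₀ (moment_nonneg hw (hw_int _))
    (moment_le_moment hw (hw_int _) (hw_int _) (Nat.zero_le _)) (by positivity)
    (le_self_pow₀ hk two_ne_zero)

/-- Base case of Lemma 2: if the moments of a Bergman weight `w` satisfy
`h₄ ≤ 2h₂²/(1+h₂)`, then `h₄/2 ≤ h₂·ln(∑ h_{2k}/(k!)²)`. -/
theorem lemma_two_base_case (w : ℝ → ℝ)
    (hw_nonneg : ∀ ρ ∈ Set.Ico (0:ℝ) 1, 0 ≤ w ρ)
    (hw_int : ∀ m : ℕ, IntervalIntegrable (fun ρ => ρ ^ (m + 1) * w ρ) volume 0 1)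
    (h0 : moment w 0 = 1)
    (h24 : moment w 4 ≤ 2 * (moment w 2) ^ 2 / (1 + moment w 2)) :
    moment w 4 / 2 ≤
      moment w 2 *
        Real.log (∑' k : ℕ, moment w (2 * k) / (Nat.factorial k : ℝ) ^ 2) := by
  have hx : 0 ≤ moment w 2 := moment_nonneg hw_nonneg (hw_int 2)
  have hsum : 1 + moment w 2 ≤ ∑' k : ℕ, moment w (2 * k) / (Nat.factorial k : ℝ) ^ 2 := by
    have h := (summable_moment_div_factorial_sq hw_nonneg hw_int).sum_le_tsum
      (Finset.range 2)
      fun k _ => div_nonneg (moment_nonneg hw_nonneg (hw_int _)) (sq_nonneg _)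
    simpa [Finset.sum_range_succ, h0] using h
  calc moment w 4 / 2 ≤ (2 * (moment w 2) ^ 2 / (1 + moment w 2)) / 2 := by gcongr
    _ = moment w 2 * (1 - (1 + moment w 2)⁻¹) := by
      have : 1 + moment w 2 ≠ 0 := by positivity
      field_simp
      ring
    _ ≤ moment w 2 * Real.log (1 + moment w 2) := by
      gcongr
      exact Real.one_sub_inv_le_log_of_pos (by positivity)
    _ ≤ _ := by gcongr
end

section
/- Let (g_n)_{n≥0} be a sequence of real numbers with g_0 = 1, 0 < g_n ≤ g_{n-1} for all n ≥ 1, and g_n/g_{n-1} ≥ (n/(n+1))·g_{n+1}/g_n for all n ≥ 1. Then the function q ↦ ln(∑_{n=0}^∞ q^n g_n/(n!)²) is concave on (0, ∞); equivalently, for every q > 0, (∑_{n=0}^∞ q^n g_{n+2}/((n!)²(n+1)(n+2)))·(∑_{n=0}^∞ q^n g_n/(n!)²) ≤ (∑_{n=0}^∞ q^n g_{n+1}/((n!)²(n+1)))². -/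
open Filter Topology Finset

/-- The binomial transform of a positive log-concave sequence is again log-concave. -/
theorem sum_choose_mul_pow_logConcave {b : ℕ → ℝ} (hpos : ∀ n, 0 < b n)
    (hlc : ∀ n, b n * b (n + 2) ≤ b (n + 1) ^ 2) {t : ℝ} (ht : 0 ≤ t) (N k : ℕ) :
    (∑ j ∈ range (N + 1), (N.choose j : ℝ) * t ^ j * b (k + j)) *
        (∑ j ∈ range (N + 1), (N.choose j : ℝ) * t ^ j * b (k + 2 + j)) ≤
      (∑ j ∈ range (N + 1), (N.choose j : ℝ) * t ^ j * b (k + 1 + j)) ^ 2 := by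
  set B : ℕ → ℕ → ℝ := fun N k ↦ ∑ j ∈ range (N + 1), (N.choose j : ℝ) * t ^ j * b (k + j) with hB
  have hrec : ∀ N k, B (N + 1) k = B N k + t * B N (k + 1) := by
    intro N k
    have hext : B N k = ∑ j ∈ range (N + 1 + 1), (N.choose j : ℝ) * t ^ j * b (k + j) := by
      rw [sum_range_succ]
      simp [hB]
    rw [hext, sum_range_succ']
    simp only [hB]
    rw [sum_range_succ', mul_sum, add_right_comm, ← sum_add_distrib]
    congr 1
    · refine sum_congr rfl fun j _ ↦ ?_
      rw [Nat.choose_succ_succ, show k + 1 + j = k + (j + 1) by ring]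
      push_cast
      ring
    · simp
  have key : ∀ N, (∀ k, 0 < B N k) ∧ ∀ k, B N k * B N (k + 2) ≤ B N (k + 1) ^ 2 := by
    intro N
    induction N with
    | zero => exact ⟨fun k ↦ by simpa [hB] using hpos k, fun k ↦ by simpa [hB] using hlc k⟩
    | succ N ih =>
      obtain ⟨ihpos, ihlc⟩ := ih
      refine ⟨fun k ↦ ?_, fun k ↦ ?_⟩
      · rw [hrec]
        have := ihpos k
        have := ihpos (k + 1)
        positivity
      · have h0 := ihpos k
        have h1 := ihpos (k + 1)
        have h2 := ihpos (k + 2)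
        have h3 := ihpos (k + 3)
        have h02 : B N k * B N (k + 2) ≤ B N (k + 1) ^ 2 := ihlc k
        have h13 : B N (k + 1) * B N (k + 3) ≤ B N (k + 2) ^ 2 := ihlc (k + 1)
        have h03 : B N k * B N (k + 3) ≤ B N (k + 1) * B N (k + 2) := by
          refine le_of_mul_le_mul_right ?_ (mul_pos h1 h2)
          calc B N k * B N (k + 3) * (B N (k + 1) * B N (k + 2))
              = (B N k * B N (k + 2)) * (B N (k + 1) * B N (k + 3)) := by ring
            _ ≤ B N (k + 1) ^ 2 * B N (k + 2) ^ 2 := by gcongr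
            _ = _ := by ring
        rw [hrec, hrec, hrec]
        change (B N k + t * B N (k + 1)) * (B N (k + 2) + t * B N (k + 3)) ≤
          (B N (k + 1) + t * B N (k + 2)) ^ 2
        have := mul_le_mul_of_nonneg_left h03 ht
        have := mul_le_mul_of_nonneg_left h13 (sq_nonneg t)
        linarith
  exact (key N).2 k

theorem summable_pow_mul_div_factorial {b : ℕ → ℝ} {C : ℝ} (hb : ∀ n, |b n| ≤ C) (q : ℝ) :
    Summable fun n ↦ q ^ n * b n / (n.factorial : ℝ) := by
  refine Summable.of_norm_bounded ((Real.summable_pow_div_factorial |q|).mul_left C) fun n ↦ ?_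
  rw [Real.norm_eq_abs, abs_div, abs_mul, abs_pow, Nat.abs_cast, mul_comm, ← mul_div_assoc]
  gcongr
  exact hb n

/-- The binomial sums `∑ⱼ C(N, j) (q / N)ʲ bⱼ` of a bounded sequence converge to its exponential
generating function at `q`. -/
theorem tendsto_sum_choose_mul_pow {b : ℕ → ℝ} {C : ℝ} (hb : ∀ n, |b n| ≤ C) (q : ℝ) :
    Tendsto (fun N : ℕ ↦ ∑ j ∈ range (N + 1), (N.choose j : ℝ) * (q / N) ^ j * b j) atTop
      (𝓝 (∑' n, q ^ n * b n / (n.factorial : ℝ))) := by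
  have hsum : ∀ N : ℕ, ∑ j ∈ range (N + 1), (N.choose j : ℝ) * (q / N) ^ j * b j =
      ∑' j, (N.choose j : ℝ) * (q / N) ^ j * b j := fun N ↦ by
    refine (tsum_eq_sum fun j hj ↦ ?_).symm
    rw [Nat.choose_eq_zero_of_lt (by simpa using hj)]
    simp
  simp_rw [hsum]
  refine tendsto_tsum_of_dominated_convergence
    ((Real.summable_pow_div_factorial |q|).mul_right C) (fun j ↦ ?_) (Eventually.of_forall ?_)
  · have hq : Tendsto (fun N : ℕ ↦ (N : ℝ) * (q / N)) atTop (𝓝 q) :=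
      tendsto_const_nhds.congr' <| by
        filter_upwards [eventually_ne_atTop 0] with N hN
        field_simp
    convert (ProbabilityTheory.tendsto_choose_mul_pow_atTop (k := j) hq).mul_const (b j) using 2
    ring
  · intro N j
    rw [Real.norm_eq_abs, abs_mul, abs_mul, abs_pow, Nat.abs_cast, abs_div, Nat.abs_cast]
    refine mul_le_mul ?_ (hb j) (abs_nonneg _) (by positivity)
    calc (N.choose j : ℝ) * (|q| / N) ^ j
        ≤ ((N : ℝ) ^ j / j.factorial) * (|q| / N) ^ j := by
          gcongr
          exact Nat.choose_le_pow_div j N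
      _ = (N * (|q| / N)) ^ j / j.factorial := by rw [mul_pow]; ring
      _ ≤ |q| ^ j / j.factorial := by
          gcongr
          rcases eq_or_ne (N : ℝ) 0 with hN | hN
          · simp [hN]
          · exact (mul_div_cancel₀ _ hN).le

/-- Log-concavity in the shift of the exponential generating function of a bounded positive
log-concave sequence. -/
theorem tsum_mul_tsum_shift_le_sq {b : ℕ → ℝ} {C : ℝ} (hpos : ∀ n, 0 < b n) (hb : ∀ n, |b n| ≤ C)
    (hlc : ∀ n, b n * b (n + 2) ≤ b (n + 1) ^ 2) {q : ℝ} (hq : 0 ≤ q) :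
    (∑' n, q ^ n * b (n + 2) / (n.factorial : ℝ)) * (∑' n, q ^ n * b n / (n.factorial : ℝ)) ≤
      (∑' n, q ^ n * b (n + 1) / (n.factorial : ℝ)) ^ 2 := by
  refine le_of_tendsto_of_tendsto'
    ((tendsto_sum_choose_mul_pow (fun n ↦ hb (n + 2)) q).mul (tendsto_sum_choose_mul_pow hb q))
    ((tendsto_sum_choose_mul_pow (fun n ↦ hb (n + 1)) q).pow 2) fun N ↦ ?_
  have h := sum_choose_mul_pow_logConcave hpos hlc (t := q / N) (by positivity) N 0
  simp only [zero_add, add_comm 1, add_comm 2] at h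
  rwa [mul_comm] at h

/-- The exponential generating function of a bounded sequence is differentiated by shifting the
sequence. -/
theorem hasDerivAt_tsum_pow_mul_div_factorial {b : ℕ → ℝ} {C : ℝ} (hb : ∀ n, |b n| ≤ C) (q : ℝ) :
    HasDerivAt (fun x ↦ ∑' n, x ^ n * b n / (n.factorial : ℝ))
      (∑' n, q ^ n * b (n + 1) / (n.factorial : ℝ)) q := by
  have hshift : ∀ (x : ℝ) (c : ℕ → ℝ) (n : ℕ),
      ((n + 1 : ℕ) : ℝ) * x ^ (n + 1 - 1) * c (n + 1) / ((n + 1).factorial : ℝ) =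
        x ^ n * c (n + 1) / (n.factorial : ℝ) := fun x c n ↦ by
    rw [Nat.factorial_succ, add_tsub_cancel_right]
    push_cast
    field_simp
  have hsummable : ∀ (x : ℝ) {c : ℕ → ℝ}, (∀ n, |c n| ≤ C) →
      Summable fun n : ℕ ↦ (n : ℝ) * x ^ (n - 1) * c n / (n.factorial : ℝ) := fun x c hc ↦ by
    rw [← summable_nat_add_iff 1]
    simp_rw [hshift]
    exact summable_pow_mul_div_factorial (fun n ↦ hc (n + 1)) x
  have hval : ∑' n, q ^ n * b (n + 1) / (n.factorial : ℝ) =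
      ∑' n : ℕ, (n : ℝ) * q ^ (n - 1) * b n / (n.factorial : ℝ) := by
    rw [(hsummable q hb).tsum_eq_zero_add]
    simp_rw [hshift]
    simp
  have hC : 0 ≤ C := (abs_nonneg _).trans (hb 0)
  rw [hval]
  refine hasDerivAt_tsum_of_isPreconnected
    (g := fun n x ↦ x ^ n * b n / (n.factorial : ℝ))
    (g' := fun n x ↦ (n : ℝ) * x ^ (n - 1) * b n / (n.factorial : ℝ))
    (t := Metric.ball 0 (|q| + 1)) (y₀ := q)
    (hsummable (|q| + 1) (c := fun _ ↦ C) fun _ ↦ (abs_of_nonneg hC).le)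
    Metric.isOpen_ball (convex_ball _ _).isPreconnected (fun n y _ ↦ ?_) (fun n y hy ↦ ?_)
    (by simp) (summable_pow_mul_div_factorial hb q) (by simp)
  · exact ((hasDerivAt_pow n y).mul_const _).div_const _
  · rw [mem_ball_zero_iff, Real.norm_eq_abs] at hy
    rw [Real.norm_eq_abs, abs_div, abs_mul, abs_mul, abs_pow, Nat.abs_cast, Nat.abs_cast]
    gcongr
    exact hb n

/-- The exponential generating function of a bounded positive log-concave sequence is log-concave
on `(0, ∞)`. -/
theorem concaveOn_log_tsum_pow_mul_div_factorial {b : ℕ → ℝ} {C : ℝ} (hpos : ∀ n, 0 < b n)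
    (hb : ∀ n, |b n| ≤ C) (hlc : ∀ n, b n * b (n + 2) ≤ b (n + 1) ^ 2) :
    ConcaveOn ℝ (Set.Ioi 0) fun q ↦ Real.log (∑' n, q ^ n * b n / (n.factorial : ℝ)) := by
  have hE : ∀ q ∈ Set.Ioi (0 : ℝ), 0 < ∑' n, q ^ n * b n / (n.factorial : ℝ) := fun q hq ↦ by
    rw [Set.mem_Ioi] at hq
    refine (summable_pow_mul_div_factorial hb q).tsum_pos (fun n ↦ ?_) 0 ?_
    · have := hpos n
      positivity
    · simpa using hpos 0
  have hd := hasDerivAt_tsum_pow_mul_div_factorial hb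
  have hd' := hasDerivAt_tsum_pow_mul_div_factorial fun n ↦ hb (n + 1)
  have hlog := fun q hq ↦ (hd q).log (hE q hq).ne'
  refine concaveOn_of_hasDerivWithinAt2_nonpos (convex_Ioi 0)
    (fun q hq ↦ (hlog q hq).continuousAt.continuousWithinAt)
    (fun q hq ↦ (hlog q (interior_subset hq)).hasDerivWithinAt)
    (fun q hq ↦ ((hd' q).div (hd q) (hE q (interior_subset hq)).ne').hasDerivWithinAt)
    fun q hq ↦ ?_
  refine div_nonpos_of_nonpos_of_nonneg ?_ (sq_nonneg _)
  rw [sub_nonpos, ← sq]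
  exact tsum_mul_tsum_shift_le_sq hpos hb hlc (le_of_lt (interior_subset hq : q ∈ Set.Ioi 0))

/-- Log-concavity in `q` of `∑ qⁿ g_n/(n!)²` for a positive nonincreasing sequence `g`
with `g₀ = 1` satisfying `g_n/g_{n-1} ≥ (n/(n+1))·g_{n+1}/g_n`: the function
`q ↦ ln(∑ qⁿ g_n/(n!)²)` is concave on `(0,∞)`; equivalently, for every `q > 0`,
`(∑ qⁿ g_{n+2}/((n!)²(n+1)(n+2)))·(∑ qⁿ g_n/(n!)²) ≤ (∑ qⁿ g_{n+1}/((n!)²(n+1)))²`. -/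
theorem log_concavity (g : ℕ → ℝ) (hg0 : g 0 = 1)
    (hgpos : ∀ n : ℕ, 1 ≤ n → 0 < g n)
    (hgmono : ∀ n : ℕ, 1 ≤ n → g n ≤ g (n - 1))
    (hcond : ∀ n : ℕ, 1 ≤ n →
      ((n : ℝ) / (n + 1)) * (g (n + 1) / g n) ≤ g n / g (n - 1)) :
    ConcaveOn ℝ (Set.Ioi (0:ℝ))
        (fun q => Real.log (∑' n : ℕ, q ^ n * g n / (Nat.factorial n : ℝ) ^ 2)) ∧
    ∀ q : ℝ, 0 < q →
      (∑' n : ℕ, q ^ n * g (n + 2) / ((Nat.factorial n : ℝ) ^ 2 * (n + 1) * (n + 2))) *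
          (∑' n : ℕ, q ^ n * g n / (Nat.factorial n : ℝ) ^ 2) ≤
        (∑' n : ℕ, q ^ n * g (n + 1) / ((Nat.factorial n : ℝ) ^ 2 * (n + 1))) ^ 2 := by
  have hpos : ∀ n, 0 < g n := fun n ↦ by
    rcases n.eq_zero_or_pos with rfl | hn
    · simp [hg0]
    · exact hgpos n hn
  have hle : ∀ n, g n ≤ 1 := fun n ↦ by
    induction n with
    | zero => exact hg0.le
    | succ n ih => exact (hgmono (n + 1) n.succ_pos).trans ih
  set b : ℕ → ℝ := fun n ↦ g n / n.factorial with hb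
  have hbpos : ∀ n, 0 < b n := fun n ↦ div_pos (hpos n) (by positivity)
  have hbC : ∀ n, |b n| ≤ 1 := fun n ↦ by
    rw [abs_of_pos (hbpos n)]
    refine div_le_one_of_le₀ ((hle n).trans ?_) (by positivity)
    exact_mod_cast n.factorial_pos
  have hlc : ∀ n, b n * b (n + 2) ≤ b (n + 1) ^ 2 := fun n ↦ by
    have h := hcond (n + 1) n.succ_pos
    have h0 := hpos n
    have h1 := hpos (n + 1)
    rw [add_tsub_cancel_right, div_mul_div_comm, div_le_div_iff₀ (by positivity) h0] at h
    push_cast at h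
    simp only [hb, Nat.factorial_succ]
    push_cast
    rw [div_mul_div_comm, div_pow, div_le_div_iff₀ (by positivity) (by positivity)]
    have hf : (0 : ℝ) ≤ (n + 1) * (n.factorial : ℝ) ^ 2 := by positivity
    have := mul_le_mul_of_nonneg_left h hf
    linarith
  have h0 : ∀ (q : ℝ) (n : ℕ), q ^ n * g n / (n.factorial : ℝ) ^ 2 =
      q ^ n * b n / n.factorial := fun q n ↦ by
    simp only [hb]
    field_simp
  have h1 : ∀ (q : ℝ) (n : ℕ), q ^ n * g (n + 1) / ((n.factorial : ℝ) ^ 2 * (n + 1)) =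
      q ^ n * b (n + 1) / n.factorial := fun q n ↦ by
    simp only [hb, Nat.factorial_succ]
    push_cast
    field_simp
  have h2 : ∀ (q : ℝ) (n : ℕ),
      q ^ n * g (n + 2) / ((n.factorial : ℝ) ^ 2 * (n + 1) * (n + 2)) =
        q ^ n * b (n + 2) / n.factorial := fun q n ↦ by
    simp only [hb, Nat.factorial_succ]
    push_cast
    field_simp
    ring
  simp_rw [h0, h1, h2]
  exact ⟨concaveOn_log_tsum_pow_mul_div_factorial hbpos hbC hlc,
    fun q hq ↦ tsum_mul_tsum_shift_le_sq hbpos hbC hlc hq.le⟩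
end

section
/- For every real x with 0 < x ≤ 1, one has x + x²/(1+x) ≤ (1+x)·ln(1 + x + x²/(2+2x)); equivalently, the function y(x) = x + x²/(1+x) − (1+x)·ln(1 + x + x²/(2(1+x))) satisfies y(x) ≤ 0 on (0,1], with the derivative of y(x)/(1+x) equal to −x²(2 + 3x + 3x²)/((1+x)³(2 + 4x + 3x²)) ≤ 0. -/
theorem hasDerivAt_log_defect {x : ℝ} (hx : 0 ≤ x) :
    HasDerivAt
      (fun s : ℝ =>
        (s + s ^ 2 / (1 + s) - (1 + s) * Real.log (1 + s + s ^ 2 / (2 * (1 + s)))) / (1 + s))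
      (-(x ^ 2 * (2 + 3 * x + 3 * x ^ 2) / ((1 + x) ^ 3 * (2 + 4 * x + 3 * x ^ 2)))) x := by
  have h1 : 1 + x ≠ 0 := by positivity
  have hq : 2 + 4 * x + 3 * x ^ 2 ≠ 0 := by positivity
  have hu : 1 + x + x ^ 2 / (2 * (1 + x)) = (2 + 4 * x + 3 * x ^ 2) / (2 * (1 + x)) := by
    field_simp
    ring
  have hu0 : 1 + x + x ^ 2 / (2 * (1 + x)) ≠ 0 := by positivity
  have d1 : HasDerivAt (fun s : ℝ => 1 + s) 1 x := (hasDerivAt_id x).const_add 1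
  have dsq : HasDerivAt (fun s : ℝ => s ^ 2) (2 * x) x := by
    simpa using hasDerivAt_pow 2 x
  have dlog := (d1.fun_add (dsq.fun_div (d1.const_mul 2) (mul_ne_zero two_ne_zero h1))).log hu0
  have d := (((hasDerivAt_id' x).fun_add (dsq.fun_div d1 h1)).fun_sub
    (d1.fun_mul dlog)).fun_div d1 h1
  refine d.congr_deriv ?_
  rw [hu]
  generalize Real.log ((2 + 4 * x + 3 * x ^ 2) / (2 * (1 + x))) = L
  field_simp
  ring

theorem log_defect_deriv_nonpos {x : ℝ} (hx : 0 ≤ x) :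
    -(x ^ 2 * (2 + 3 * x + 3 * x ^ 2) / ((1 + x) ^ 3 * (2 + 4 * x + 3 * x ^ 2))) ≤ 0 :=
  neg_nonpos.mpr (by positivity)

/-- Elementary inequality: for `0 < x ≤ 1`,
`x + x²/(1+x) ≤ (1+x)·ln(1 + x + x²/(2+2x))`; equivalently the function
`y(x) = x + x²/(1+x) − (1+x)·ln(1 + x + x²/(2(1+x)))` satisfies `y(x) ≤ 0` on
`(0,1]`, with the derivative of `y(x)/(1+x)` equal to
`−x²(2+3x+3x²)/((1+x)³(2+4x+3x²)) ≤ 0`. -/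
theorem elementary_log_inequality (x : ℝ) (hx0 : 0 < x) (hx1 : x ≤ 1) :
    x + x ^ 2 / (1 + x) ≤ (1 + x) * Real.log (1 + x + x ^ 2 / (2 + 2 * x)) ∧
    HasDerivAt
      (fun s : ℝ =>
        (s + s ^ 2 / (1 + s) - (1 + s) * Real.log (1 + s + s ^ 2 / (2 * (1 + s)))) / (1 + s))
      (-(x ^ 2 * (2 + 3 * x + 3 * x ^ 2) / ((1 + x) ^ 3 * (2 + 4 * x + 3 * x ^ 2)))) x ∧
    -(x ^ 2 * (2 + 3 * x + 3 * x ^ 2) / ((1 + x) ^ 3 * (2 + 4 * x + 3 * x ^ 2))) ≤ 0 := by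
  refine ⟨?_, hasDerivAt_log_defect hx0.le, log_defect_deriv_nonpos hx0.le⟩
  have anti := antitoneOn_of_hasDerivWithinAt_nonpos (convex_Ici (0 : ℝ))
    (fun s hs => (hasDerivAt_log_defect hs).continuousAt.continuousWithinAt)
    (fun s hs => (hasDerivAt_log_defect (interior_subset hs)).hasDerivWithinAt)
    (fun s hs => log_defect_deriv_nonpos (interior_subset hs))
  have h := anti Set.self_mem_Ici hx0.le hx0.le
  have h0 : (x + x ^ 2 / (1 + x) - (1 + x) * Real.log (1 + x + x ^ 2 / (2 * (1 + x)))) / (1 + x)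
      ≤ 0 := by simpa using h
  rw [div_le_iff₀ (by positivity), zero_mul, mul_add, mul_one] at h0
  linarith
end
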